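/- For all integers 0 ≤ l ≤ n and 0 ≤ k ≤ m with (n, l) ≠ (m, k), the Kelvin-transformed Appell functions are orthogonal over the exterior of the unit ball: ∫_{B⁻} conj(K(A_n^l)(x))·K(A_m^k)(x) dx = 0; moreover for all 0 ≤ l ≤ n, ∫_{B⁻} |K(A_n^l)(x)|² dx = ((2n+3)/(2n+1))·∫_{B⁺} |A_n^l(x)|² dx. -/

import Mathlib

open MeasureTheory Metric Finset

noncomputable section

/-- `ℝ³` with the Euclidean norm and Lebesgue measure. -/
abbrev R3 := EuclideanSpace ℝ (Fin 3)
/-- the real quaternions ℍ -/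
abbrev QH := Quaternion ℝ

/-- the basis quaternion e₁ -/
def e1 : QH := ⟨0,1,0,0⟩
/-- the basis quaternion e₂ -/
def e2 : QH := ⟨0,0,1,0⟩
/-- the basis quaternion e₃ -/
def e3 : QH := ⟨0,0,0,1⟩

/-- embed a point of ℝ³ as the reduced quaternion x₀ + x₁e₁ + x₂e₂ -/
def toQ (x : R3) : QH := ⟨x 0, x 1, x 2, 0⟩
/-- the conjugate reduced quaternion x₀ - x₁e₁ - x₂e₂ -/
def toQbar (x : R3) : QH := ⟨x 0, -(x 1), -(x 2), 0⟩
/-- ζ = x₁ - x₂e₃ -/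
def zeta (x : R3) : QH := ⟨x 1, 0, 0, -(x 2)⟩

/-- build a point of ℝ³ from coordinates -/
def mk3 (a b c : ℝ) : R3 := (WithLp.equiv 2 (Fin 3 → ℝ)).symm ![a, b, c]

/-- the conjugated point (x₀, -x₁, -x₂) -/
def barPt (x : R3) : R3 := mk3 (x 0) (-(x 1)) (-(x 2))

/-- partial derivative ∂f/∂xᵢ -/
def pd (i : Fin 3) (f : R3 → QH) (x : R3) : QH :=
  fderiv ℝ f x (EuclideanSpace.single i 1)

/-- the generalized Cauchy-Riemann operator ∂̄f = ∂f/∂x₀ + e₁∂f/∂x₁ + e₂∂f/∂x₂ -/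
def CRbar (f : R3 → QH) (x : R3) : QH :=
  pd 0 f x + e1 * pd 1 f x + e2 * pd 2 f x

/-- the adjoint generalized Cauchy-Riemann operator ∂f = ∂f/∂x₀ - e₁∂f/∂x₁ - e₂∂f/∂x₂ -/
def Dadj (f : R3 → QH) (x : R3) : QH :=
  pd 0 f x - e1 * pd 1 f x - e2 * pd 2 f x

/-- the hypercomplex derivative ∂₀ = (1/2)∂ -/
def D0 (f : R3 → QH) : R3 → QH := fun x =>
  (1/2 : ℝ) • (pd 0 f x - e1 * pd 1 f x - e2 * pd 2 f x)

/-- the operator ∂̄_ℂ f = (1/2)(∂f/∂x₁ + e₃∂f/∂x₂) -/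
def DbarC (f : R3 → QH) : R3 → QH := fun x =>
  (1/2 : ℝ) • (pd 1 f x + e3 * pd 2 f x)

/-- the involution f⁰ + f¹e₁ + f²e₂ + f³e₃ ↦ f⁰ - f¹e₁ - f²e₂ + f³e₃ -/
def invol (a : QH) : QH := ⟨a.re, -a.imI, -a.imJ, a.imK⟩

/-- the inner Appell polynomial A_n^l -/
def appell (n l : ℕ) (x : R3) : QH :=
  ((n.factorial * l.factorial : ℝ) /
      (2 ^ (2 * (n - l)) * (n + l + 1).factorial * (2 * l).factorial)) •
    ((∑ h ∈ Finset.range (n - l + 1),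
        (((2 * n - 2 * h + 1).factorial * (2 * l + 2 * h).factorial : ℝ) /
            (h.factorial * (n - l - h).factorial * (n - h).factorial * (l + h).factorial)) •
          (toQbar x ^ h * toQ x ^ (n - l - h))) * zeta x ^ l)

/-- the Kelvin transform K(P)(x) = (x̄/|x|³)·P(x̄/|x|²) -/
def kelvin (P : R3 → QH) (x : R3) : QH :=
  ((‖x‖ ^ 3)⁻¹ • toQbar x) * P ((‖x‖ ^ 2)⁻¹ • barPt x)

/-- the outer Appell function A_{-(n+2)}^l -/
def outerAppell (n l : ℕ) (x : R3) : QH :=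
  (((n + l + 1).factorial * (n - l).factorial : ℝ) / (n.factorial * (n + 1).factorial)) •
    kelvin (appell n l) x

/-- surface integral over the sphere of radius ρ (parametrized by the unit sphere
with its surface measure, with the Jacobian factor ρ²) -/
def sphereIntegral (ρ : ℝ) (g : R3 → QH) : QH :=
  ∫ ω : sphere (0 : R3) 1, (ρ ^ 2) • g (ρ • (ω : R3)) ∂((volume : Measure R3).toSphere)

/-- the unified family ψ_k^l, k ∈ ℤ \ {-1}: inner Appell polynomials for k ≥ 0,
outer Appell functions for k ≤ -2 -/
def psiFam (k : ℤ) (l : ℕ) (x : R3) : QH :=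
  if 0 ≤ k then appell k.toNat l x else outerAppell (-k - 2).toNat l x
/-! ### Quaternion algebra -/

section components

variable (x : R3)

@[simp] lemma QH_zero_re : (0 : QH).re = 0 := rfl
@[simp] lemma QH_zero_imI : (0 : QH).imI = 0 := rfl
@[simp] lemma QH_zero_imJ : (0 : QH).imJ = 0 := rfl
@[simp] lemma QH_zero_imK : (0 : QH).imK = 0 := rfl
@[simp] lemma QH_one_re : (1 : QH).re = 1 := rfl
@[simp] lemma QH_one_imI : (1 : QH).imI = 0 := rfl
@[simp] lemma QH_one_imJ : (1 : QH).imJ = 0 := rfl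
@[simp] lemma QH_one_imK : (1 : QH).imK = 0 := rfl
@[simp] lemma e1_re : e1.re = 0 := rfl
@[simp] lemma e1_imI : e1.imI = 1 := rfl
@[simp] lemma e1_imJ : e1.imJ = 0 := rfl
@[simp] lemma e1_imK : e1.imK = 0 := rfl
@[simp] lemma e2_re : e2.re = 0 := rfl
@[simp] lemma e2_imI : e2.imI = 0 := rfl
@[simp] lemma e2_imJ : e2.imJ = 1 := rfl
@[simp] lemma e2_imK : e2.imK = 0 := rfl
@[simp] lemma e3_re : e3.re = 0 := rfl
@[simp] lemma e3_imI : e3.imI = 0 := rfl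
@[simp] lemma e3_imJ : e3.imJ = 0 := rfl
@[simp] lemma e3_imK : e3.imK = 1 := rfl
@[simp] lemma toQ_re : (toQ x).re = x 0 := rfl
@[simp] lemma toQ_imI : (toQ x).imI = x 1 := rfl
@[simp] lemma toQ_imJ : (toQ x).imJ = x 2 := rfl
@[simp] lemma toQ_imK : (toQ x).imK = 0 := rfl
@[simp] lemma toQbar_re : (toQbar x).re = x 0 := rfl
@[simp] lemma toQbar_imI : (toQbar x).imI = -x 1 := rfl
@[simp] lemma toQbar_imJ : (toQbar x).imJ = -x 2 := rfl
@[simp] lemma toQbar_imK : (toQbar x).imK = 0 := rfl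
@[simp] lemma zeta_re : (zeta x).re = x 1 := rfl
@[simp] lemma zeta_imI : (zeta x).imI = 0 := rfl
@[simp] lemma zeta_imJ : (zeta x).imJ = 0 := rfl
@[simp] lemma zeta_imK : (zeta x).imK = -x 2 := rfl

end components

lemma star_toQ (x : R3) : star (toQ x) = toQbar x := by
  apply Quaternion.ext <;> simp

lemma star_toQbar (x : R3) : star (toQbar x) = toQ x := by
  rw [← star_toQ, star_star]

lemma norm_sq_eq (x : R3) : ‖x‖ ^ 2 = x 0 ^ 2 + x 1 ^ 2 + x 2 ^ 2 := by
  simp [EuclideanSpace.norm_sq_eq, Fin.sum_univ_three]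

lemma toQ_mul_toQbar (x : R3) : toQ x * toQbar x = (‖x‖ ^ 2) • (1 : QH) := by
  rw [norm_sq_eq]
  apply Quaternion.ext <;> simp <;> ring

lemma toQbar_mul_toQ (x : R3) : toQbar x * toQ x = (‖x‖ ^ 2) • (1 : QH) := by
  rw [norm_sq_eq]
  apply Quaternion.ext <;> simp <;> ring

lemma commute_toQ_toQbar (x : R3) : Commute (toQ x) (toQbar x) :=
  (toQ_mul_toQbar x).trans (toQbar_mul_toQ x).symm

/-- Monomials in `x` and `x̄` have no `e₃`-component. -/
lemma imK_toQbar_pow_mul_toQ_pow (x : R3) (h M : ℕ) : (toQbar x ^ h * toQ x ^ M).imK = 0 := by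
  have span : ∀ P : QH, P ∈ Submodule.span ℝ {(1 : QH), toQ x} → P.imK = 0 := by
    intro P hP
    obtain ⟨a, b, rfl⟩ := Submodule.mem_span_pair.1 hP
    simp
  apply span
  have right : ∀ M : ℕ, toQ x ^ M ∈ Submodule.span ℝ {(1 : QH), toQ x} := by
    intro M
    induction M with
    | zero => exact Submodule.subset_span (by simp)
    | succ M ih =>
      obtain ⟨a, b, hab⟩ := Submodule.mem_span_pair.1 ih
      refine Submodule.mem_span_pair.2 ⟨-b * ‖x‖ ^ 2, a + b * (2 * x 0), ?_⟩
      rw [pow_succ (toQ x), ← hab, norm_sq_eq]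
      apply Quaternion.ext <;> simp <;> ring
  induction h with
  | zero => simpa using right M
  | succ h ih =>
    obtain ⟨a, b, hab⟩ := Submodule.mem_span_pair.1 ih
    refine Submodule.mem_span_pair.2 ⟨a * (2 * x 0) + b * ‖x‖ ^ 2, -a, ?_⟩
    rw [pow_succ' (toQbar x), mul_assoc, ← hab, norm_sq_eq]
    apply Quaternion.ext <;> simp <;> ring

lemma star_toQbar_pow_mul_toQ_pow (x : R3) (h M : ℕ) :
    star (toQbar x ^ h * toQ x ^ M) = toQ x ^ h * toQbar x ^ M := by
  rw [star_mul, star_pow, star_pow, star_toQ, star_toQbar]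
  exact ((commute_toQ_toQbar x).symm.pow_pow _ _)

lemma sandwich_basis {P : QH} (hP : P.imK = 0) : P + e1 * P * e1 + e2 * P * e2 = -star P := by
  apply Quaternion.ext <;> simp [hP]

lemma sandwich_basis_star {P : QH} (hP : P.imK = 0) :
    P - e1 * P * e1 - e2 * P * e2 = (2 : ℝ) • P + star P := by
  apply Quaternion.ext <;> simp [hP] <;> ring

lemma toQ_sub_toQbar_mul_twist {P : QH} (hP : P.imK = 0) (x : R3) :
    (toQ x - toQbar x) * (e1 * P - e2 * P * e3) = -(2 : ℝ) • ((P - star P) * zeta x) := by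
  apply Quaternion.ext <;> simp [hP] <;> ring

/-! ### Partial derivatives -/

/-- `toQ` as a linear map. -/
def toQLin : R3 →ₗ[ℝ] QH where
  toFun := toQ
  map_add' x y := by apply Quaternion.ext <;> simp
  map_smul' c x := by apply Quaternion.ext <;> simp

/-- `toQbar` as a linear map. -/
def toQbarLin : R3 →ₗ[ℝ] QH where
  toFun := toQbar
  map_add' x y := by apply Quaternion.ext <;> simp <;> ring
  map_smul' c x := by apply Quaternion.ext <;> simp

/-- `zeta` as a linear map. -/
def zetaLin : R3 →ₗ[ℝ] QH where
  toFun := zeta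
  map_add' x y := by
    apply Quaternion.ext <;> simp
    ring
  map_smul' c x := by apply Quaternion.ext <;> simp

lemma contDiff_toQ : ContDiff ℝ 1 toQ := toQLin.toContinuousLinearMap.contDiff
lemma contDiff_toQbar : ContDiff ℝ 1 toQbar := toQbarLin.toContinuousLinearMap.contDiff
lemma contDiff_zeta : ContDiff ℝ 1 zeta := zetaLin.toContinuousLinearMap.contDiff

lemma differentiable_toQ : Differentiable ℝ toQ := toQLin.toContinuousLinearMap.differentiable
lemma differentiable_toQbar : Differentiable ℝ toQbar :=
  toQbarLin.toContinuousLinearMap.differentiable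
lemma differentiable_zeta : Differentiable ℝ zeta := zetaLin.toContinuousLinearMap.differentiable

lemma pd_toQ (i : Fin 3) (x : R3) : pd i toQ x = toQ (EuclideanSpace.single i 1) :=
  DFunLike.congr_fun (toQLin.toContinuousLinearMap.fderiv (x := x)) _

lemma pd_toQbar (i : Fin 3) (x : R3) : pd i toQbar x = toQbar (EuclideanSpace.single i 1) :=
  DFunLike.congr_fun (toQbarLin.toContinuousLinearMap.fderiv (x := x)) _

lemma pd_zeta (i : Fin 3) (x : R3) : pd i zeta x = zeta (EuclideanSpace.single i 1) :=
  DFunLike.congr_fun (zetaLin.toContinuousLinearMap.fderiv (x := x)) _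

lemma pd_mul (i : Fin 3) {f g : R3 → QH} {x : R3} (hf : DifferentiableAt ℝ f x)
    (hg : DifferentiableAt ℝ g x) :
    pd i (fun y => f y * g y) x = f x * pd i g x + pd i f x * g x := by
  simp [pd, fderiv_fun_mul' hf hg]

lemma pd_pow (i : Fin 3) {f : R3 → QH} {x : R3} (hf : DifferentiableAt ℝ f x) (N : ℕ) :
    pd i (fun y => f y ^ N) x = ∑ j ∈ range N, f x ^ j * pd i f x * f x ^ (N - 1 - j) := by
  induction N with
  | zero => simp [pd]
  | succ N ih =>
    simp only [pow_succ]
    rw [pd_mul i (hf.fun_pow N) hf, ih, sum_range_succ, sum_mul, add_comm]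
    congr 1
    · refine sum_congr rfl fun j hj => ?_
      have hj := mem_range.1 hj
      rw [mul_assoc, ← pow_succ]
      congr 2
      omega
    · simp

lemma toQ_single (i : Fin 3) : toQ (EuclideanSpace.single i 1) = ![1, e1, e2] i := by
  fin_cases i <;> apply Quaternion.ext <;> simp

lemma toQbar_single (i : Fin 3) : toQbar (EuclideanSpace.single i 1) = ![1, -e1, -e2] i := by
  fin_cases i <;> apply Quaternion.ext <;> simp

lemma zeta_single (i : Fin 3) : zeta (EuclideanSpace.single i 1) = ![0, 1, -e3] i := by
  fin_cases i <;> apply Quaternion.ext <;> simp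

lemma commute_zeta_e3 (x : R3) : Commute (zeta x) e3 := by
  apply Quaternion.ext <;> simp

lemma CRbar_toQ_pow_twisted (x : R3) (P : QH) (M : ℕ)
    (hP : ∀ j, (P * toQ x ^ j).imK = 0) :
    P * pd 0 (fun y => toQ y ^ M) x + e1 * (P * pd 1 (fun y => toQ y ^ M) x)
      + e2 * (P * pd 2 (fun y => toQ y ^ M) x)
      = -∑ j ∈ range M, star (P * toQ x ^ j) * toQ x ^ (M - 1 - j) := by
  simp only [pd_pow _ (differentiable_toQ x), pd_toQ, toQ_single, mul_sum, ← sum_add_distrib,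
    ← sum_neg_distrib]
  refine sum_congr rfl fun j _ => ?_
  rw [← neg_mul, ← sandwich_basis (hP j)]
  simp [add_mul, mul_assoc]

lemma CRbar_toQbar_pow (x : R3) (h : ℕ) :
    CRbar (fun y => toQbar y ^ h) x
      = ∑ j ∈ range h, ((2 : ℝ) • toQbar x ^ j + toQ x ^ j) * toQbar x ^ (h - 1 - j) := by
  simp only [CRbar, pd_pow _ (differentiable_toQbar x), pd_toQbar, toQbar_single, mul_sum,
    ← sum_add_distrib]
  refine sum_congr rfl fun j _ => ?_
  have hk : (toQbar x ^ j).imK = 0 := by simpa using imK_toQbar_pow_mul_toQ_pow x j 0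
  have hs : star (toQbar x ^ j) = toQ x ^ j := by rw [star_pow, star_toQbar]
  rw [← hs, ← sandwich_basis_star hk]
  simp [add_mul, mul_assoc, sub_eq_add_neg]

lemma pd_zeta_pow (i : Fin 3) (x : R3) (l : ℕ) :
    pd i (fun y => zeta y ^ l) x = (l : ℝ) • (![0, 1, -e3] i * zeta x ^ (l - 1)) := by
  rw [pd_pow _ (differentiable_zeta x), pd_zeta, zeta_single]
  have hc : Commute (![0, 1, -e3] i : QH) (zeta x) := by
    fin_cases i
    · exact Commute.zero_left _
    · exact Commute.one_left _
    · exact (commute_zeta_e3 x).symm.neg_left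
  rw [sum_congr rfl (g := fun _ => ![0, 1, -e3] i * zeta x ^ (l - 1))]
  · simp [← Nat.cast_smul_eq_nsmul ℝ]
  · intro j hj
    have hj := mem_range.1 hj
    rw [((hc.symm.pow_left j).eq), mul_assoc, ← pow_add]
    congr 2
    omega

/-- The generalized Cauchy-Riemann operator on a monomial, multiplied by `x - x̄`. -/
lemma toQ_sub_toQbar_mul_CRbar_monomial (x : R3) (h M l : ℕ) :
    (toQ x - toQbar x) * CRbar (fun y => toQbar y ^ h * toQ y ^ M * zeta y ^ l) x =
      ((2 * h : ℝ) • (toQbar x ^ (h - 1) * toQ x ^ (M + 1))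
        - (2 * h + 2 * l + 1 : ℝ) • (toQbar x ^ h * toQ x ^ M)
        + (2 * l + 1 : ℝ) • (toQ x ^ h * toQbar x ^ M)) * zeta x ^ l := by
  have dz := differentiable_toQ x
  have db := differentiable_toQbar x
  have dζ := differentiable_zeta x
  have cz := commute_toQ_toQbar x
  set P := toQbar x ^ h * toQ x ^ M with hPdef
  have hP : P.imK = 0 := imK_toQbar_pow_mul_toQ_pow x h M
  have hsP : star P = toQ x ^ h * toQbar x ^ M := star_toQbar_pow_mul_toQ_pow x h M
  have key : CRbar (fun y => toQbar y ^ h * toQ y ^ M * zeta y ^ l) x =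
      CRbar (fun y => toQbar y ^ h) x * toQ x ^ M * zeta x ^ l
      + (toQbar x ^ h * pd 0 (fun y => toQ y ^ M) x
        + e1 * (toQbar x ^ h * pd 1 (fun y => toQ y ^ M) x)
        + e2 * (toQbar x ^ h * pd 2 (fun y => toQ y ^ M) x)) * zeta x ^ l
      + (l : ℝ) • ((e1 * P - e2 * P * e3) * zeta x ^ (l - 1)) := by
    simp only [CRbar]
    rw [pd_mul 0 ((db.fun_pow h).fun_mul (dz.fun_pow M)) (dζ.fun_pow l),
      pd_mul 1 ((db.fun_pow h).fun_mul (dz.fun_pow M)) (dζ.fun_pow l),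
      pd_mul 2 ((db.fun_pow h).fun_mul (dz.fun_pow M)) (dζ.fun_pow l)]
    simp only [pd_mul _ (db.fun_pow h) (dz.fun_pow M), pd_zeta_pow]
    simp [← hPdef, mul_add, add_mul, mul_assoc, sub_eq_add_neg]
    abel
  have zterm : (toQ x - toQbar x) * (toQbar x ^ h * pd 0 (fun y => toQ y ^ M) x
        + e1 * (toQbar x ^ h * pd 1 (fun y => toQ y ^ M) x)
        + e2 * (toQbar x ^ h * pd 2 (fun y => toQ y ^ M) x)) = star P - toQ x ^ (h + M) := by
    rw [CRbar_toQ_pow_twisted x _ M (imK_toQbar_pow_mul_toQ_pow x h)]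
    simp only [star_toQbar_pow_mul_toQ_pow]
    have e : ∑ j ∈ range M, toQ x ^ h * toQbar x ^ j * toQ x ^ (M - 1 - j)
        = toQ x ^ h * ∑ j ∈ range M, toQbar x ^ j * toQ x ^ (M - 1 - j) := by
      simp [mul_sum, mul_assoc]
    have g := cz.symm.mul_geom_sum₂ M
    have c : Commute (toQ x - toQbar x) (toQ x ^ h) :=
      ((Commute.refl _).pow_right h).sub_left (cz.symm.pow_right h)
    rw [e, mul_neg, ← mul_assoc, c.eq, mul_assoc, ← mul_neg, ← neg_mul, neg_sub, g, hsP, mul_sub,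
      pow_add]
  have bterm : (toQ x - toQbar x) * CRbar (fun y => toQbar y ^ h) x * toQ x ^ M
      = (2 * h : ℝ) • (toQbar x ^ (h - 1) * toQ x ^ (M + 1)) - (2 * h : ℝ) • P
        + toQ x ^ (h + M) - P := by
    rw [CRbar_toQbar_pow]
    have e : ∑ j ∈ range h, ((2 : ℝ) • toQbar x ^ j + toQ x ^ j) * toQbar x ^ (h - 1 - j)
        = (2 * h : ℝ) • toQbar x ^ (h - 1)
          + ∑ j ∈ range h, toQ x ^ j * toQbar x ^ (h - 1 - j) := by
      simp only [add_mul, sum_add_distrib]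
      congr 1
      rw [sum_congr rfl (g := fun _ => (2 : ℝ) • toQbar x ^ (h - 1))]
      · simp [← Nat.cast_smul_eq_nsmul ℝ, smul_smul, mul_comm]
      · intro j hj
        have hj := mem_range.1 hj
        rw [smul_mul_assoc, ← pow_add]
        congr 2
        omega
    rw [e, mul_add, cz.mul_geom_sum₂, mul_smul_comm, sub_mul, (cz.pow_right (h - 1)).eq,
      pow_add (toQ x) h M, hPdef, add_mul, smul_mul_assoc, sub_mul, sub_mul, smul_sub, mul_assoc,
      ← pow_succ' (toQ x)]
    rcases h with _ | h
    · simp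
    · simp only [Nat.add_sub_cancel, ← pow_succ' (toQbar x)]
      abel
  have ζterm : (toQ x - toQbar x) * ((l : ℝ) • ((e1 * P - e2 * P * e3) * zeta x ^ (l - 1)))
      = -(2 * l : ℝ) • ((P - star P) * zeta x ^ l) := by
    rw [mul_smul_comm, ← mul_assoc, toQ_sub_toQbar_mul_twist hP]
    rcases l with _ | l
    · simp
    · simp only [Nat.add_sub_cancel, smul_mul_assoc, mul_assoc, ← pow_succ', smul_smul]
      congr 1
      ring
  rw [key, mul_add, mul_add, ζterm, ← mul_assoc, ← mul_assoc, ← mul_assoc, zterm, bterm, ← hsP,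
    ← smul_mul_assoc _ (P - star P), ← add_mul, ← add_mul]
  congr 1
  module

/-- The building block of the coefficients of the Appell polynomials. -/
def appellCoeff (l k : ℕ) : ℝ :=
  (2 * l + 2 * k).factorial / (k.factorial * (l + k).factorial)

lemma appellCoeff_succ (l k : ℕ) :
    (k + 1) * appellCoeff l (k + 1) = 2 * (2 * l + 2 * k + 1) * appellCoeff l k := by
  have h1 : 2 * l + 2 * (k + 1) = 2 * l + 2 * k + 1 + 1 := by ring
  unfold appellCoeff
  rw [h1, ← add_assoc l k 1, Nat.factorial_succ, Nat.factorial_succ, Nat.factorial_succ k,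
    Nat.factorial_succ (l + k)]
  push_cast
  field_simp
  ring

/-- The Appell polynomials in terms of `appellCoeff`. -/
lemma appell_add_eq (N l : ℕ) : ∃ c : ℝ, appell (l + N) l = fun x =>
    c • ∑ h ∈ range (N + 1), ((2 * l + 2 * (N - h : ℕ) + 1) * appellCoeff l (N - h)
      * appellCoeff l h) • (toQbar x ^ h * toQ x ^ (N - h) * zeta x ^ l) := by
  refine ⟨((l + N).factorial * l.factorial : ℝ) /
    (2 ^ (2 * (l + N - l)) * (l + N + l + 1).factorial * (2 * l).factorial), funext fun x => ?_⟩
  unfold appell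
  rw [Nat.add_sub_cancel_left, sum_mul]
  congr 1
  refine sum_congr rfl fun h hh => ?_
  have hN : h ≤ N := Nat.lt_succ_iff.1 (mem_range.1 hh)
  rw [smul_mul_assoc]
  congr 1
  have h1 : 2 * (l + N) - 2 * h + 1 = 2 * l + 2 * (N - h) + 1 := by omega
  have h2 : l + N - h = l + (N - h) := by omega
  rw [h1, h2, Nat.factorial_succ]
  unfold appellCoeff
  push_cast [hN]
  field_simp

lemma CRbar_sum_smul {ι : Type*} (s : Finset ι) (c : ℝ) (a : ι → ℝ) (f : ι → R3 → QH) (x : R3)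
    (hf : ∀ i ∈ s, DifferentiableAt ℝ (f i) x) :
    CRbar (fun y => c • ∑ i ∈ s, a i • f i y) x = c • ∑ i ∈ s, a i • CRbar (f i) x := by
  have e : ∀ v, fderiv ℝ (fun y => c • ∑ i ∈ s, a i • f i y) x v
      = c • ∑ i ∈ s, a i • fderiv ℝ (f i) x v := by
    intro v
    have := (HasFDerivAt.fun_sum fun i hi =>
      ((hf i hi).hasFDerivAt.fun_const_smul (a i))).fun_const_smul c
    rw [this.fderiv]
    simp
  simp only [CRbar, pd, e, mul_smul_comm, mul_sum, smul_add, sum_add_distrib]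

/-- The Appell polynomials are monogenic; stated off a null set. -/
lemma CRbar_appell {n l : ℕ} (hl : l ≤ n) {x : R3} (hx : x 1 ≠ 0) :
    CRbar (appell n l) x = 0 := by
  obtain ⟨N, rfl⟩ := Nat.exists_eq_add_of_le hl
  obtain ⟨c, hc⟩ := appell_add_eq N l
  have dz := differentiable_toQ x
  have db := differentiable_toQbar x
  have dζ := differentiable_zeta x
  have hne : toQ x - toQbar x ≠ 0 := by
    intro h
    have := congrArg QuaternionAlgebra.imI h
    simp at this
    exact hx (by linarith)
  rw [hc, CRbar_sum_smul]
  swap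
  · intro h _
    exact ((db.fun_pow h).fun_mul (dz.fun_pow _)).fun_mul (dζ.fun_pow l)
  suffices hs : (toQ x - toQbar x) * ∑ h ∈ range (N + 1),
      ((2 * l + 2 * (N - h : ℕ) + 1) * appellCoeff l (N - h) * appellCoeff l h) •
        CRbar (fun y => toQbar y ^ h * toQ y ^ (N - h) * zeta y ^ l) x = 0 by
    rw [(mul_eq_zero.1 hs).resolve_left hne, smul_zero]
  simp only [mul_sum, mul_smul_comm, toQ_sub_toQbar_mul_CRbar_monomial]
  simp only [← smul_mul_assoc _ (_ + _) (zeta x ^ l)]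
  rw [← sum_mul]
  convert zero_mul _
  simp only [smul_add, smul_sub, sum_add_distrib, sum_sub_distrib]
  have first : ∑ h ∈ range (N + 1),
      ((2 * l + 2 * (N - h : ℕ) + 1) * appellCoeff l (N - h) * appellCoeff l h) •
        (2 * h : ℝ) • (toQbar x ^ (h - 1) * toQ x ^ (N - h + 1))
      = ∑ h ∈ range (N + 1), (2 * (2 * l + 2 * h + 1) * appellCoeff l h * (N - h : ℕ)
        * appellCoeff l (N - h)) • (toQbar x ^ h * toQ x ^ (N - h)) := by
    rw [sum_range_succ', sum_range_succ]
    simp only [Nat.cast_zero, mul_zero, zero_smul, smul_zero, add_zero, Nat.sub_self, zero_mul]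
    refine sum_congr rfl fun h hh => ?_
    obtain ⟨M, rfl⟩ : ∃ M, N = h + M + 1 := ⟨N - h - 1, by have := mem_range.1 hh; omega⟩
    have h1 : h + M + 1 - (h + 1) = M := by omega
    have h2 : h + M + 1 - h = M + 1 := by omega
    rw [h1, h2, smul_smul, Nat.add_sub_cancel]
    congr 1
    have a := appellCoeff_succ l h
    have b := appellCoeff_succ l M
    push_cast
    linear_combination 2 * (2 * l + 2 * M + 1) * appellCoeff l M * a
      - 2 * (2 * l + 2 * h + 1) * appellCoeff l h * b
  have third : ∑ h ∈ range (N + 1),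
      ((2 * l + 2 * (N - h : ℕ) + 1) * appellCoeff l (N - h) * appellCoeff l h) •
        (2 * l + 1 : ℝ) • (toQ x ^ h * toQbar x ^ (N - h))
      = ∑ h ∈ range (N + 1), ((2 * l + 1) * (2 * l + 2 * h + 1) * appellCoeff l h
        * appellCoeff l (N - h)) • (toQbar x ^ h * toQ x ^ (N - h)) := by
    rw [← sum_flip]
    refine sum_congr rfl fun h hh => ?_
    have hN : h ≤ N := Nat.lt_succ_iff.1 (mem_range.1 hh)
    rw [Nat.sub_sub_self hN, smul_smul, ((commute_toQ_toQbar x).pow_pow _ _).eq]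
    congr 1
    ring
  rw [first, third, ← sum_sub_distrib, ← sum_add_distrib]
  refine sum_eq_zero fun h hh => ?_
  rw [smul_smul, ← sub_smul, ← add_smul]
  convert zero_smul ℝ _
  ring

lemma contDiff_appell (n l : ℕ) : ContDiff ℝ 1 (appell n l) := by
  have hz := contDiff_toQ
  have hb := contDiff_toQbar
  have hζ := contDiff_zeta
  unfold appell
  refine ContDiff.const_smul _ (ContDiff.mul (ContDiff.sum fun h _ => ContDiff.const_smul _ ?_)
    (hζ.pow l))
  exact (hb.pow h).mul (hz.pow _)

lemma toQ_smul (t : ℝ) (x : R3) : toQ (t • x) = t • toQ x := toQLin.map_smul t x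
lemma toQbar_smul (t : ℝ) (x : R3) : toQbar (t • x) = t • toQbar x := toQbarLin.map_smul t x
lemma zeta_smul (t : ℝ) (x : R3) : zeta (t • x) = t • zeta x := zetaLin.map_smul t x

/-- The Appell polynomial `A_n^l` is homogeneous of degree `n`. -/
lemma appell_smul {n l : ℕ} (hl : l ≤ n) (t : ℝ) (x : R3) :
    appell n l (t • x) = t ^ n • appell n l x := by
  obtain ⟨N, rfl⟩ := Nat.exists_eq_add_of_le hl
  obtain ⟨c, hc⟩ := appell_add_eq N l
  rw [hc]
  simp only [toQ_smul, toQbar_smul, zeta_smul, smul_pow, smul_mul_smul_comm, smul_sum]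
  refine sum_congr rfl fun h hh => ?_
  have hN : h ≤ N := Nat.lt_succ_iff.1 (mem_range.1 hh)
  rw [← pow_add, ← pow_add, show h + (N - h) + l = l + N by omega]
  simp only [smul_smul]
  congr 1
  ring

/-- Euler's identity for homogeneous functions. -/
lemma fderiv_self_of_homogeneous {f : R3 → QH} {n : ℕ} (hf : ContDiff ℝ 1 f)
    (hom : ∀ (t : ℝ) x, f (t • x) = t ^ n • f x) (x : R3) :
    fderiv ℝ f x x = (n : ℝ) • f x := by
  have h1 : HasDerivAt (fun t : ℝ => f (t • x)) (fderiv ℝ f x x) 1 := by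
    have hx : HasDerivAt (fun t : ℝ => t • x) ((1 : ℝ) • x) 1 :=
      (hasDerivAt_id (1 : ℝ)).smul_const x
    have hd : HasFDerivAt f (fderiv ℝ f x) ((1 : ℝ) • x) := by
      rw [one_smul]
      exact (hf.differentiable one_ne_zero x).hasFDerivAt
    have := hd.comp_hasDerivAt (1 : ℝ) hx
    rw [one_smul] at this
    exact this
  have h2 : HasDerivAt (fun t : ℝ => f (t • x)) ((n : ℝ) • f x) 1 := by
    simp only [hom]
    simpa using (hasDerivAt_pow n (1 : ℝ)).smul_const (f x)
  exact h1.unique h2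

/-! ### Integration by parts -/

lemma continuous_pd {f : R3 → QH} (hf : ContDiff ℝ 1 f) (i : Fin 3) : Continuous (pd i f) :=
  (hf.continuous_fderiv one_ne_zero).clm_apply continuous_const

lemma hasCompactSupport_pd {f : R3 → QH} (hf : HasCompactSupport f) (i : Fin 3) :
    HasCompactSupport (pd i f) :=
  hf.fderiv_apply ℝ _

lemma integrable_pd {f : R3 → QH} (hf : ContDiff ℝ 1 f) (hc : HasCompactSupport f) (i : Fin 3) :
    Integrable (pd i f) :=
  (continuous_pd hf i).integrable_of_hasCompactSupport (hasCompactSupport_pd hc i)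

lemma integral_pd_eq_zero {f : R3 → QH} (hf : ContDiff ℝ 1 f) (hc : HasCompactSupport f)
    (i : Fin 3) : ∫ x, pd i f x = 0 := by
  have := integral_smul_fderiv_eq_neg_fderiv_smul_of_integrable (μ := (volume : Measure R3))
    (f := fun _ : R3 => (1 : ℝ)) (g := f) (v := EuclideanSpace.single i 1)
    (by simp) (by simp only [one_smul]; exact integrable_pd hf hc i)
    (by simpa using hf.continuous.integrable_of_hasCompactSupport hc) (by simp)
    (fun x _ => hf.differentiable one_ne_zero x)
  simpa [pd] using this

/-- Quaternion conjugation as a continuous linear equivalence. -/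
def starCLE : QH ≃L[ℝ] QH :=
  LinearEquiv.toContinuousLinearEquiv
    { toFun := star
      invFun := star
      map_add' := star_add
      map_smul' := fun c a => by apply Quaternion.ext <;> simp
      left_inv := star_star
      right_inv := star_star }

lemma starCLE_apply (a : QH) : starCLE a = star a := rfl

lemma pd_star (i : Fin 3) (f : R3 → QH) (x : R3) :
    pd i (fun y => star (f y)) x = star (pd i f x) :=
  DFunLike.congr_fun (starCLE.comp_fderiv (f := f) (x := x)) _

lemma pd_smul (i : Fin 3) {χ : R3 → ℝ} {f : R3 → QH} {x : R3} (hχ : DifferentiableAt ℝ χ x)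
    (hf : DifferentiableAt ℝ f x) :
    pd i (fun y => χ y • f y) x
      = χ x • pd i f x + fderiv ℝ χ x (EuclideanSpace.single i 1) • f x := by
  simp [pd, fderiv_fun_smul hχ hf]

lemma clm_apply_eq_sum {F : Type*} [NormedAddCommGroup F] [NormedSpace ℝ F] (L : R3 →L[ℝ] F)
    (x : R3) : L x = x 0 • L (EuclideanSpace.single 0 1) + x 1 • L (EuclideanSpace.single 1 1)
      + x 2 • L (EuclideanSpace.single 2 1) := by
  have hx : x = x 0 • EuclideanSpace.single 0 (1 : ℝ) + x 1 • EuclideanSpace.single 1 (1 : ℝ)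
      + x 2 • EuclideanSpace.single 2 (1 : ℝ) := by
    ext i
    fin_cases i <;> simp
  conv_lhs => rw [hx]
  simp only [map_add, map_smul]

lemma adjoint_basis_toQ (x : R3) (a b c : QH) :
    toQ x * a - e1 * (toQ x * b) - e2 * (toQ x * c)
      = (2 : ℝ) • (x 0 • a + x 1 • b + x 2 • c) - toQbar x * (a + e1 * b + e2 * c) := by
  apply Quaternion.ext <;> simp <;> ring

lemma star_e1 : star e1 = -e1 := by apply Quaternion.ext <;> simp
lemma star_e2 : star e2 = -e2 := by apply Quaternion.ext <;> simp
lemma e1_mul_e1 : e1 * e1 = -1 := by apply Quaternion.ext <;> simp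
lemma e2_mul_e2 : e2 * e2 = -1 := by apply Quaternion.ext <;> simp

lemma toQbar_eq (x : R3) : toQbar x = x 0 • (1 : QH) - x 1 • e1 - x 2 • e2 := by
  apply Quaternion.ext <;> simp

/-- Stokes' formula for a monogenic pair `f`, `h` with a radial cut-off `χ`. -/
lemma integral_monogenic_pairing {f h : R3 → QH} {m : ℕ} (hf : ContDiff ℝ 1 f)
    (hh : ContDiff ℝ 1 h) (hom : ∀ (t : ℝ) x, h (t • x) = t ^ m • h x)
    (hfD : ∀ᵐ x, CRbar f x = 0) (hhD : ∀ᵐ x, CRbar h x = 0) {χ : R3 → ℝ}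
    (hχ : ContDiff ℝ 1 χ) (hc : HasCompactSupport χ)
    (hrad : ∀ x, ∃ c : ℝ, ∀ i, fderiv ℝ χ x (EuclideanSpace.single i 1) = c * x i) :
    ∫ x, ((3 + 2 * m) * χ x + fderiv ℝ χ x x) • (star (f x) * h x) = 0 := by
  set G : QH → R3 → QH := fun e x => star (f x) * (e * (toQ x * h x)) with hG
  have hGd : ∀ e, ContDiff ℝ 1 (G e) := fun e =>
    (starCLE.contDiff.comp hf).mul (contDiff_const.mul (contDiff_toQ.mul hh))
  set F : QH → R3 → QH := fun e x => χ x • G e x with hF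
  have hFd : ∀ e, ContDiff ℝ 1 (F e) := fun e => hχ.smul (hGd e)
  have hFc : ∀ e, HasCompactSupport (F e) := fun e => hc.smul_right
  have hsum : ∫ x, (pd 0 (F 1) x - pd 1 (F e1) x - pd 2 (F e2) x) = 0 := by
    rw [integral_sub, integral_sub]
    · simp [integral_pd_eq_zero (hFd _) (hFc _)]
    · exact integrable_pd (hFd _) (hFc _) _
    · exact integrable_pd (hFd _) (hFc _) _
    · exact (integrable_pd (hFd _) (hFc _) _).sub (integrable_pd (hFd _) (hFc _) _)
    · exact integrable_pd (hFd _) (hFc _) _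
  rw [← hsum]
  refine integral_congr_ae ?_
  filter_upwards [hfD, hhD] with x hfx hhx
  have dχ := hχ.differentiable one_ne_zero x
  have df := hf.differentiable one_ne_zero x
  have dh := hh.differentiable one_ne_zero x
  have dxh : DifferentiableAt ℝ (fun y => toQ y * h y) x := (differentiable_toQ x).fun_mul dh
  have hpd : ∀ i e, pd i (F e) x = χ x • (star (f x) * (e * (toQ x * pd i h x
      + ![1, e1, e2] i * h x)) + star (pd i f x) * (e * (toQ x * h x)))
      + fderiv ℝ χ x (EuclideanSpace.single i 1) • G e x := by
    intro i e
    rw [hF, pd_smul i dχ ((hGd e).differentiable one_ne_zero x), hG,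
      pd_mul i (f := fun y => star (f y)) (starCLE.differentiableAt.comp x df)
        (dxh.const_mul e), pd_star,
      pd_mul i (differentiableAt_const e) dxh, pd_mul i (differentiable_toQ x) dh, pd_toQ,
      toQ_single]
    have : pd i (fun _ => e) x = 0 := by simp [pd]
    rw [this]
    simp
  obtain ⟨c, hcx⟩ := hrad x
  have hχx : fderiv ℝ χ x x = c * ‖x‖ ^ 2 := by
    rw [clm_apply_eq_sum, hcx, hcx, hcx, norm_sq_eq]
    simp only [smul_eq_mul]
    ring
  have euler := fderiv_self_of_homogeneous hh hom x
  rw [clm_apply_eq_sum] at euler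
  have hsf : star (pd 0 f x) - star (pd 1 f x) * e1 - star (pd 2 f x) * e2 = 0 := by
    have := congrArg star hfx
    simpa [CRbar, star_e1, star_e2, sub_eq_add_neg] using this
  have t1 : star (pd 0 f x) * (toQ x * h x) - star (pd 1 f x) * (e1 * (toQ x * h x))
      - star (pd 2 f x) * (e2 * (toQ x * h x)) = 0 := by
    rw [← mul_assoc (star (pd 1 f x)), ← mul_assoc (star (pd 2 f x)), ← sub_mul, ← sub_mul, hsf,
      zero_mul]
  have t2 : toQ x * pd 0 h x - e1 * (toQ x * pd 1 h x) - e2 * (toQ x * pd 2 h x)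
      = (2 * m : ℝ) • h x := by
    rw [adjoint_basis_toQ]
    have : pd 0 h x + e1 * pd 1 h x + e2 * pd 2 h x = 0 := hhx
    rw [this, mul_zero, sub_zero]
    simp only [pd]
    rw [euler, smul_smul]
  have t3 : x 0 • (toQ x * h x) - x 1 • (e1 * (toQ x * h x)) - x 2 • (e2 * (toQ x * h x))
      = ‖x‖ ^ 2 • h x := by
    have := congrArg (· * h x) (toQbar_mul_toQ x)
    simpa [toQbar_eq, sub_mul, mul_assoc] using this
  have s1 : e1 * (e1 * h x) = -h x := by rw [← mul_assoc, e1_mul_e1, neg_one_mul]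
  have s2 : e2 * (e2 * h x) = -h x := by rw [← mul_assoc, e2_mul_e2, neg_one_mul]
  have expand : pd 0 (F 1) x - pd 1 (F e1) x - pd 2 (F e2) x
      = χ x • (star (f x) * (toQ x * pd 0 h x - e1 * (toQ x * pd 1 h x) - e2 * (toQ x * pd 2 h x))
        + star (f x) * (h x - e1 * (e1 * h x) - e2 * (e2 * h x))
        + (star (pd 0 f x) * (toQ x * h x) - star (pd 1 f x) * (e1 * (toQ x * h x))
      - star (pd 2 f x) * (e2 * (toQ x * h x))))
        + c • (star (f x) * (x 0 • (toQ x * h x) - x 1 • (e1 * (toQ x * h x))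
          - x 2 • (e2 * (toQ x * h x)))) := by
    rw [hpd, hpd, hpd, hcx, hcx, hcx, hG]
    simp [mul_add, mul_sub, smul_sub, smul_smul]
    abel
  rw [expand, t1, t2, t3, s1, s2, hχx]
  simp only [mul_smul_comm, mul_sub, mul_neg]
  module

/-- Monogenic homogeneous functions of different degrees are orthogonal with respect to every
radial cut-off. -/
lemma integral_radial_monogenic_eq_zero {f h : R3 → QH} {n m : ℕ} (hnm : n ≠ m)
    (hf : ContDiff ℝ 1 f) (hh : ContDiff ℝ 1 h) (fhom : ∀ (t : ℝ) x, f (t • x) = t ^ n • f x)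
    (hhom : ∀ (t : ℝ) x, h (t • x) = t ^ m • h x)
    (hfD : ∀ᵐ x, CRbar f x = 0) (hhD : ∀ᵐ x, CRbar h x = 0) {χ : R3 → ℝ}
    (hχ : ContDiff ℝ 1 χ) (hc : HasCompactSupport χ)
    (hrad : ∀ x, ∃ c : ℝ, ∀ i, fderiv ℝ χ x (EuclideanSpace.single i 1) = c * x i) :
    ∫ x, χ x • (star (f x) * h x) = 0 := by
  have cont : Continuous fun x => star (f x) * h x := hf.continuous.star.mul hh.continuous
  have hχ' : Continuous fun x => fderiv ℝ χ x x :=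
    (hχ.continuous_fderiv one_ne_zero).clm_apply continuous_id
  have hc' : HasCompactSupport fun x => fderiv ℝ χ x x :=
    (hc.fderiv ℝ).mono fun x hx h0 => hx (by simp [h0])
  have i1 : Integrable fun x => χ x • (star (f x) * h x) :=
    (hχ.continuous.smul cont).integrable_of_hasCompactSupport hc.smul_right
  have i2 : Integrable fun x => fderiv ℝ χ x x • (star (f x) * h x) :=
    (hχ'.smul cont).integrable_of_hasCompactSupport hc'.smul_right
  have split : ∀ k : ℕ, ∫ x, ((3 + 2 * k) * χ x + fderiv ℝ χ x x) • (star (f x) * h x)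
      = (3 + 2 * k : ℝ) • (∫ x, χ x • (star (f x) * h x))
        + ∫ x, fderiv ℝ χ x x • (star (f x) * h x) := by
    intro k
    have i3 : Integrable fun x => (3 + 2 * k : ℝ) • χ x • (star (f x) * h x) :=
      i1.smul (3 + 2 * k : ℝ)
    rw [← integral_smul, ← integral_add i3 i2]
    simp only [add_smul, smul_smul]
  have p1 := integral_monogenic_pairing hf hh hhom hfD hhD hχ hc hrad
  have p2 := congrArg star (integral_monogenic_pairing hh hf fhom hhD hfD hχ hc hrad)
  have hstar : star (∫ x, ((3 + 2 * n) * χ x + fderiv ℝ χ x x) • (star (h x) * f x))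
      = ∫ x, ((3 + 2 * n) * χ x + fderiv ℝ χ x x) • (star (f x) * h x) := by
    rw [← starCLE_apply, ← starCLE.integral_comp_comm]
    refine integral_congr_ae (.of_forall fun x => ?_)
    simp only [map_smul, starCLE_apply, star_mul, star_star]
  rw [hstar, star_zero, split] at p2
  rw [split] at p1
  have hne : (2 * m - 2 * n : ℝ) ≠ 0 := by
    intro h0
    exact hnm (by exact_mod_cast (by linarith : (n : ℝ) = m))
  have key : (2 * m - 2 * n : ℝ) • (∫ x, χ x • (star (f x) * h x)) = 0 := by
    rw [← sub_zero (0 : QH)]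
    nth_rw 1 [← p1]
    rw [← p2]
    module
  exact (smul_eq_zero.1 key).resolve_left hne

/-! ### Polar coordinates -/

/-- Integration in polar coordinates of a product of a radial and an angular function. -/
lemma integral_radial_smul_angular {E : Type*} [NormedAddCommGroup E] [NormedSpace ℝ E]
    (w : ℝ → ℝ) (F : R3 → E) :
    ∫ x : R3, w ‖x‖ • F (‖x‖⁻¹ • x) = (∫ r in Set.Ioi (0 : ℝ), r ^ 2 * w r) •
      ∫ ω : sphere (0 : R3) 1, F ω ∂(volume : Measure R3).toSphere := by
  have hdim : Module.finrank ℝ R3 - 1 = 2 := by simp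
  calc
    ∫ x : R3, w ‖x‖ • F (‖x‖⁻¹ • x)
      = ∫ x : ({(0)}ᶜ : Set R3), w ‖x.1‖ • F (‖x.1‖⁻¹ • x.1) 
          ∂((volume : Measure R3).comap Subtype.val) := by
      rw [integral_subtype_comap (measurableSet_singleton _).compl
        fun x : R3 => w ‖x‖ • F (‖x‖⁻¹ • x), restrict_compl_singleton]
    _ = ∫ p, w p.2 • F p.1 ∂(volume : Measure R3).toSphere.prod (.volumeIoiPow 2) := by
      rw [← hdim]
      simpa using (volume : Measure R3).measurePreserving_homeomorphUnitSphereProd.integral_comp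
        (Homeomorph.measurableEmbedding _)
        (fun p : sphere (0 : R3) 1 × Set.Ioi (0 : ℝ) => w p.2 • F p.1)
    _ = (∫ r : Set.Ioi (0 : ℝ), w r ∂.volumeIoiPow 2) •
        ∫ ω : sphere (0 : R3) 1, F ω ∂(volume : Measure R3).toSphere := by
      rw [← integral_prod_smul (fun r : Set.Ioi (0 : ℝ) => w r)
        (fun ω : sphere (0 : R3) 1 => F ω), ← integral_prod_swap]
      rfl
    _ = _ := by
      congr 1
      simp only [Measure.volumeIoiPow, ENNReal.ofReal]
      rw [integral_withDensity_eq_integral_smul,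
        integral_subtype_comap measurableSet_Ioi fun a => Real.toNNReal (a ^ 2) • w a,
        setIntegral_congr_fun measurableSet_Ioi fun x hx => ?_]
      · rw [NNReal.smul_def, Real.coe_toNNReal _ (sq_nonneg _), smul_eq_mul]
      · exact (measurable_subtype_coe.pow_const _).real_toNNReal

/-! ### Rotations around the real axis -/

/-- The rotation of the plane `(x₁, x₂)` by the angle with cosine `c` and sine `-s`. -/
def rot (c s : ℝ) (h : c ^ 2 + s ^ 2 = 1) : R3 ≃ₗᵢ[ℝ] R3 where
  toFun x := mk3 (x 0) (c * x 1 + s * x 2) (c * x 2 - s * x 1)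
  invFun x := mk3 (x 0) (c * x 1 - s * x 2) (c * x 2 + s * x 1)
  map_add' x y := by
    ext i
    fin_cases i <;> simp [mk3] <;> ring
  map_smul' t x := by
    ext i
    fin_cases i <;> simp [mk3] <;> ring
  left_inv x := by
    ext i
    fin_cases i
    · simp [mk3]
    · simp [mk3]
      linear_combination x 1 * h
    · simp [mk3]
      linear_combination x 2 * h
  right_inv x := by
    ext i
    fin_cases i
    · simp [mk3]
    · simp [mk3]
      linear_combination x 1 * h
    · simp [mk3]
      linear_combination x 2 * h
  norm_map' x := by
    rw [← sq_eq_sq₀ (norm_nonneg _) (norm_nonneg _), norm_sq_eq, norm_sq_eq]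
    simp [mk3]
    linear_combination (x 1 ^ 2 + x 2 ^ 2) * h

@[simp] lemma rot_apply_zero (c s : ℝ) (h : c ^ 2 + s ^ 2 = 1) (x : R3) :
    rot c s h x 0 = x 0 := rfl
@[simp] lemma rot_apply_one (c s : ℝ) (h : c ^ 2 + s ^ 2 = 1) (x : R3) :
    rot c s h x 1 = c * x 1 + s * x 2 := rfl
@[simp] lemma rot_apply_two (c s : ℝ) (h : c ^ 2 + s ^ 2 = 1) (x : R3) :
    rot c s h x 2 = c * x 2 - s * x 1 := rfl

lemma barPt_rot (h : (-1 : ℝ) ^ 2 + 0 ^ 2 = 1) (x : R3) : barPt (rot (-1) 0 h x) = x := by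
  ext i
  fin_cases i <;> simp [barPt, mk3]

/-- The unit quaternion `cos θ + e₃ sin θ`. -/
def unitK (θ : ℝ) : QH := ⟨Real.cos θ, 0, 0, Real.sin θ⟩

@[simp] lemma unitK_re (θ : ℝ) : (unitK θ).re = Real.cos θ := rfl
@[simp] lemma unitK_imI (θ : ℝ) : (unitK θ).imI = 0 := rfl
@[simp] lemma unitK_imJ (θ : ℝ) : (unitK θ).imJ = 0 := rfl
@[simp] lemma unitK_imK (θ : ℝ) : (unitK θ).imK = Real.sin θ := rfl

lemma unitK_mul_star (θ : ℝ) : unitK θ * star (unitK θ) = 1 := by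
  apply Quaternion.ext <;> simp
  · linear_combination Real.cos_sq_add_sin_sq θ
  · ring

lemma unitK_pow (θ : ℝ) (j : ℕ) : unitK θ ^ j = unitK (j * θ) := by
  induction j with
  | zero => apply Quaternion.ext <;> simp
  | succ j ih =>
    rw [pow_succ, ih]
    apply Quaternion.ext <;> simp [add_mul, Real.cos_add, Real.sin_add]
    ring

lemma cos_sq_sub_sin_sq_sq (θ : ℝ) :
    (Real.cos θ ^ 2 - Real.sin θ ^ 2) ^ 2 + (2 * Real.cos θ * Real.sin θ) ^ 2 = 1 := by
  linear_combination (Real.cos θ ^ 2 + Real.sin θ ^ 2 + 1) * Real.cos_sq_add_sin_sq θ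

/-- The rotation implemented by conjugation with `unitK θ`. -/
def rotK (θ : ℝ) : R3 ≃ₗᵢ[ℝ] R3 := rot _ _ (cos_sq_sub_sin_sq_sq θ)

lemma toQ_rotK (θ : ℝ) (x : R3) : toQ (rotK θ x) = star (unitK θ) * toQ x * unitK θ := by
  have := Real.cos_sq_add_sin_sq θ
  apply Quaternion.ext <;> simp [rotK]
  · linear_combination -x 0 * this
  all_goals ring

lemma toQbar_rotK (θ : ℝ) (x : R3) :
    toQbar (rotK θ x) = star (unitK θ) * toQbar x * unitK θ := by
  rw [← star_toQ, toQ_rotK, star_mul, star_mul, star_star, star_toQ, mul_assoc]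

lemma zeta_rotK (θ : ℝ) (x : R3) : zeta (rotK θ x) = zeta x * unitK θ ^ 2 := by
  rw [sq]
  apply Quaternion.ext <;> simp [rotK] <;> ring

lemma commute_zeta_unitK (θ : ℝ) (x : R3) : Commute (zeta x) (unitK θ) := by
  apply Quaternion.ext <;> simp <;> ring

lemma star_mul_mul_pow {v : QH} (hv : v * star v = 1) (a : QH) (j : ℕ) :
    (star v * a * v) ^ j = star v * a ^ j * v := by
  have hv' : star v * v = 1 := by rwa [mul_eq_one_comm]
  induction j with
  | zero => simp [hv']
  | succ j ih =>
    rw [pow_succ, ih, pow_succ]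
    calc star v * a ^ j * v * (star v * a * v) = star v * a ^ j * (v * star v) * a * v := by
          simp only [mul_assoc]
      _ = _ := by rw [hv, mul_one, mul_assoc (star v)]

lemma appell_rotK {n l : ℕ} (hl : l ≤ n) (θ : ℝ) (x : R3) :
    appell n l (rotK θ x) = star (unitK θ) * appell n l x * unitK θ ^ (2 * l + 1) := by
  obtain ⟨N, rfl⟩ := Nat.exists_eq_add_of_le hl
  obtain ⟨c, hc⟩ := appell_add_eq N l
  have hv := unitK_mul_star θ
  rw [hc]
  simp only [toQ_rotK, toQbar_rotK, zeta_rotK, mul_smul_comm, smul_mul_assoc, mul_sum, sum_mul]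
  congr 1
  refine sum_congr rfl fun h _ => ?_
  congr 1
  have hζ := commute_zeta_unitK θ x
  rw [star_mul_mul_pow hv, star_mul_mul_pow hv, (hζ.pow_right 2).mul_pow, ← pow_mul]
  calc _ = star (unitK θ) * toQbar x ^ h * (unitK θ * star (unitK θ)) * toQ x ^ (N - h)
        * (unitK θ * zeta x ^ l) * unitK θ ^ (2 * l) := by simp only [mul_assoc]
    _ = _ := by
      rw [hv, mul_one, (hζ.symm.pow_right l).eq, pow_succ' _ (2 * l)]
      simp only [mul_assoc]

/-! ### Orthogonality on the sphere -/

lemma ae_apply_one_ne_zero : ∀ᵐ x : R3, x 1 ≠ 0 := by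
  have hne : LinearMap.ker (EuclideanSpace.proj (𝕜 := ℝ) (1 : Fin 3) : R3 →L[ℝ] ℝ).toLinearMap
      ≠ ⊤ := by
    intro h
    have : EuclideanSpace.single (1 : Fin 3) (1 : ℝ) ∈
        LinearMap.ker (EuclideanSpace.proj (𝕜 := ℝ) (1 : Fin 3) : R3 →L[ℝ] ℝ).toLinearMap :=
      h ▸ Submodule.mem_top
    simp at this
  have := Measure.addHaar_submodule (volume : Measure R3) _ hne
  rw [ae_iff]
  convert this using 2
  ext x
  simp

lemma CRbar_appell_ae {n l : ℕ} (hl : l ≤ n) : ∀ᵐ x, CRbar (appell n l) x = 0 :=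
  ae_apply_one_ne_zero.mono fun _ hx => CRbar_appell hl hx

/-- A smooth bump function on the real line centred at the origin. -/
def bump : ContDiffBump (0 : ℝ) := ⟨1, 2, one_pos, one_lt_two⟩

/-- A smooth radial cut-off function. -/
def radialBump (x : R3) : ℝ := bump (‖x‖ ^ 2)

lemma contDiff_radialBump : ContDiff ℝ 1 radialBump :=
  bump.contDiff.comp (contDiff_norm_sq ℝ)

lemma hasCompactSupport_radialBump : HasCompactSupport radialBump := by
  refine HasCompactSupport.intro (isCompact_closedBall (0 : R3) 2) fun x hx => ?_
  refine bump.zero_of_le_dist ?_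
  have hx : 2 < ‖x‖ := by simpa using hx
  change (2 : ℝ) ≤ _
  rw [Real.dist_0_eq_abs, abs_of_nonneg (sq_nonneg _)]
  nlinarith

lemma fderiv_radialBump (x : R3) :
    ∃ c : ℝ, ∀ i, fderiv ℝ radialBump x (EuclideanSpace.single i 1) = c * x i := by
  refine ⟨2 * deriv bump (‖x‖ ^ 2), fun i => ?_⟩
  have h1 : HasDerivAt bump (deriv bump (‖x‖ ^ 2)) (‖x‖ ^ 2) :=
    ((bump.contDiff (n := 1)).differentiable one_ne_zero _).hasDerivAt
  have h2 := h1.comp_hasFDerivAt x (hasStrictFDerivAt_norm_sq x).hasFDerivAt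
  have h3 : HasFDerivAt radialBump _ x := h2
  rw [h3.fderiv]
  simp [EuclideanSpace.inner_single_right]
  ring

lemma integrable_radialBump_smul {E : Type*} [NormedAddCommGroup E] [NormedSpace ℝ E]
    {F : R3 → E} (hF : Continuous F) : Integrable fun x => radialBump x • F x :=
  (contDiff_radialBump.continuous.smul hF).integrable_of_hasCompactSupport
    hasCompactSupport_radialBump.smul_right

lemma radialBump_rot (R : R3 ≃ₗᵢ[ℝ] R3) (x : R3) : radialBump (R x) = radialBump x := by
  simp [radialBump]

lemma continuous_star_appell_mul_appell (n l m k : ℕ) :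
    Continuous fun x => star (appell n l x) * appell m k x :=
  (contDiff_appell n l).continuous.star.mul (contDiff_appell m k).continuous

lemma integral_radialBump_appell_rotK {n l m k : ℕ} (hl : l ≤ n) (hk : k ≤ m) (θ : ℝ) :
    ∫ x, radialBump x • (star (appell n l x) * appell m k x) =
      star (unitK θ ^ (2 * l + 1)) * (∫ x, radialBump x • (star (appell n l x) * appell m k x))
        * unitK θ ^ (2 * k + 1) := by
  have hi := integrable_radialBump_smul (continuous_star_appell_mul_appell n l m k)
  rw [← integral_const_mul_of_integrable hi,
    ← integral_mul_const_of_integrable (hi.const_mul _)]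
  rw [← (rotK θ).measurePreserving.integral_comp
    (rotK θ).toHomeomorph.measurableEmbedding]
  refine integral_congr_ae (.of_forall fun x => ?_)
  simp only [radialBump_rot, appell_rotK hl, appell_rotK hk, mul_smul_comm, smul_mul_assoc]
  congr 1
  calc _ = star (unitK θ ^ (2 * l + 1)) * star (appell n l x) * (unitK θ * star (unitK θ))
        * appell m k x * unitK θ ^ (2 * k + 1) := by
        simp only [star_mul, star_star, mul_assoc]
    _ = _ := by rw [unitK_mul_star, mul_one]; simp only [mul_assoc]

/-- Rotating around the real axis separates the Appell polynomials with different `l`. -/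
lemma integral_radialBump_appell_of_ne {n l m k : ℕ} (hl : l ≤ n) (hk : k ≤ m) (hlk : l ≠ k) :
    ∫ x, radialBump x • (star (appell n l x) * appell m k x) = 0 := by
  set J := ∫ x, radialBump x • (star (appell n l x) * appell m k x) with hJ
  have hpos : (0 : ℝ) < 2 * l + 2 * k + 2 := by positivity
  set θ : ℝ := Real.pi / (2 * l + 2 * k + 2) with hθ
  have h1 : J = star (unitK θ ^ (2 * l + 1)) * J * unitK θ ^ (2 * k + 1) :=
    integral_radialBump_appell_rotK hl hk θ
  rw [unitK_pow, unitK_pow] at h1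
  set α : ℝ := (2 * l + 1 : ℕ) * θ with hα
  set β : ℝ := (2 * k + 1 : ℕ) * θ with hβ
  have h2 : unitK α * J = J * unitK β := by
    conv_lhs => rw [h1]
    rw [← mul_assoc, ← mul_assoc, unitK_mul_star, one_mul]
  have h3 : Real.cos α * Quaternion.normSq J = Real.cos β * Quaternion.normSq J := by
    have e1 := congrArg QuaternionAlgebra.re h2
    have e2 := congrArg QuaternionAlgebra.imI h2
    have e3 := congrArg QuaternionAlgebra.imJ h2
    have e4 := congrArg QuaternionAlgebra.imK h2
    simp at e1 e2 e3 e4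
    rw [Quaternion.normSq_def']
    linear_combination J.re * e1 + J.imI * e2 + J.imJ * e3 + J.imK * e4
  by_contra hne
  have hn : Quaternion.normSq J ≠ 0 := by simpa using hne
  have h4 := mul_right_cancel₀ hn h3
  have hθ0 : 0 < θ := div_pos Real.pi_pos hpos
  have hθ1 : (2 * l + 2 * k + 2) * θ = Real.pi := by rw [hθ]; field_simp
  have hlθ : 0 ≤ l * θ := by positivity
  have hkθ : 0 ≤ k * θ := by positivity
  have h5 := Real.injOn_cos (x₁ := α) (x₂ := β)
    ⟨by positivity, by rw [hα]; push_cast; nlinarith⟩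
    ⟨by positivity, by rw [hβ]; push_cast; nlinarith⟩ h4
  have h6 := mul_right_cancel₀ hθ0.ne' h5
  apply hlk
  have : 2 * l + 1 = 2 * k + 1 := by exact_mod_cast h6
  omega

lemma integral_radialBump_appell_eq_zero {n l m k : ℕ} (hl : l ≤ n) (hk : k ≤ m)
    (hne : (n, l) ≠ (m, k)) :
    ∫ x, radialBump x • (star (appell n l x) * appell m k x) = 0 := by
  by_cases hnm : n = m
  · exact integral_radialBump_appell_of_ne hl hk fun h => hne (by rw [hnm, h])
  · exact integral_radial_monogenic_eq_zero hnm (contDiff_appell n l) (contDiff_appell m k)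
      (appell_smul hl) (appell_smul hk) (CRbar_appell_ae hl) (CRbar_appell_ae hk)
      contDiff_radialBump hasCompactSupport_radialBump fderiv_radialBump

/-- The radial and the angular part of a homogeneous function. -/
lemma eq_norm_pow_smul_of_homogeneous {E : Type*} [AddCommGroup E] [Module ℝ E] {F : R3 → E}
    {N : ℕ} (hom : ∀ (t : ℝ) x, F (t • x) = t ^ N • F x) {x : R3} (hx : x ≠ 0) :
    F x = ‖x‖ ^ N • F (‖x‖⁻¹ • x) := by
  rw [← hom, smul_inv_smul₀ (norm_ne_zero_iff.2 hx)]

lemma ae_ne_zero : ∀ᵐ x : R3, x ≠ 0 := Measure.ae_ne volume 0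

lemma integral_radialBump_smul_angular {E : Type*} [NormedAddCommGroup E] [NormedSpace ℝ E]
    (N : ℕ) (G : R3 → E) :
    ∫ x : R3, (radialBump x * ‖x‖ ^ N) • G (‖x‖⁻¹ • x)
      = (∫ r in Set.Ioi (0 : ℝ), r ^ 2 * (bump (r ^ 2) * r ^ N)) •
        ∫ ω : sphere (0 : R3) 1, G ω ∂(volume : Measure R3).toSphere :=
  integral_radial_smul_angular (fun r => bump (r ^ 2) * r ^ N) G

/-- A homogeneous function that integrates to zero against the radial cut-off has mean zero on the
unit sphere. -/
lemma integral_sphere_eq_zero {E : Type*} [NormedAddCommGroup E] [NormedSpace ℝ E] {F : R3 → E}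
    {N : ℕ} (hom : ∀ (t : ℝ) x, F (t • x) = t ^ N • F x)
    (hF : ∫ x, radialBump x • F x = 0) :
    ∫ ω : sphere (0 : R3) 1, F ω ∂(volume : Measure R3).toSphere = 0 := by
  have h1 : ∫ x : R3, (radialBump x * ‖x‖ ^ N) • F (‖x‖⁻¹ • x) = 0 := by
    rw [← hF]
    refine integral_congr_ae (ae_ne_zero.mono fun x hx => ?_)
    simp only [mul_smul, ← eq_norm_pow_smul_of_homogeneous hom hx]
  have h2 : 0 < ∫ x : R3, radialBump x * ‖x‖ ^ N := by
    refine Continuous.integral_pos_of_hasCompactSupport_nonneg_nonzero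
      (x := EuclideanSpace.single 0 1) (contDiff_radialBump.continuous.mul (by fun_prop))
      hasCompactSupport_radialBump.mul_right (fun x => mul_nonneg bump.nonneg (by positivity)) ?_
    have : bump 1 = 1 := bump.one_of_mem_closedBall (by simp [bump])
    simp [radialBump, this]
  have h3 := integral_radialBump_smul_angular N (fun _ => (1 : ℝ))
  simp only [smul_eq_mul, mul_one] at h3
  rw [integral_radialBump_smul_angular] at h1
  refine (smul_eq_zero.1 h1).resolve_left fun h0 => ?_
  rw [h0, zero_mul] at h3
  exact h2.ne' h3

lemma integral_sphere_appell_eq_zero {n l m k : ℕ} (hl : l ≤ n) (hk : k ≤ m)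
    (hne : (n, l) ≠ (m, k)) :
    ∫ ω : sphere (0 : R3) 1, star (appell n l ω) * appell m k ω
      ∂(volume : Measure R3).toSphere = 0 := by
  refine integral_sphere_eq_zero (N := n + m) (F := fun x => star (appell n l x) * appell m k x)
    (fun t x => ?_) (integral_radialBump_appell_eq_zero hl hk hne)
  rw [appell_smul hl, appell_smul hk, ← starCLE_apply, map_smul, starCLE_apply,
    smul_mul_smul_comm, pow_add]

/-! ### Integrals over the ball and its exterior -/

lemma integral_ball_of_homogeneous {E : Type*} [NormedAddCommGroup E] [NormedSpace ℝ E]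
    {F : R3 → E} {N : ℕ} (hom : ∀ (t : ℝ) x, F (t • x) = t ^ N • F x) :
    ∫ x in ball (0 : R3) 1, F x =
      (1 / (N + 3) : ℝ) • ∫ ω : sphere (0 : R3) 1, F ω ∂(volume : Measure R3).toSphere := by
  have hr : ∫ r in Set.Ioi (0 : ℝ), r ^ 2 * (Set.Iio 1).indicator (fun r => r ^ N) r
      = 1 / (N + 3) := by
    have e : ∀ r : ℝ, r ^ 2 * (Set.Iio 1).indicator (fun r => r ^ N) r
        = (Set.Iio 1).indicator (fun r => r ^ (N + 2)) r := by
      intro r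
      by_cases h : r < 1 <;> simp [h, pow_add, mul_comm]
    simp only [e]
    rw [setIntegral_indicator measurableSet_Iio, Set.Ioi_inter_Iio, ← integral_Ioc_eq_integral_Ioo,
      ← intervalIntegral.integral_of_le zero_le_one, integral_pow]
    push_cast
    simp
    ring
  rw [← hr, ← integral_radial_smul_angular, ← integral_indicator measurableSet_ball]
  refine integral_congr_ae (ae_ne_zero.mono fun x hx => ?_)
  by_cases h : ‖x‖ < 1
  · simp [h, ← eq_norm_pow_smul_of_homogeneous hom hx]
  · simp [h]

lemma integral_exterior_of_inversion {E : Type*} [NormedAddCommGroup E] [NormedSpace ℝ E]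
    {F G : R3 → E} {N : ℕ}
    (hG : ∀ x, x ≠ 0 → G x = (‖x‖ ^ (N + 4))⁻¹ • F (‖x‖⁻¹ • barPt x)) :
    ∫ x in {x : R3 | 1 < ‖x‖}, G x =
      (1 / (N + 1) : ℝ) • ∫ ω : sphere (0 : R3) 1, F ω ∂(volume : Measure R3).toSphere := by
  have hr : ∫ r in Set.Ioi (0 : ℝ), r ^ 2 * (Set.Ioi 1).indicator (fun r => (r ^ (N + 4))⁻¹) r
      = 1 / (N + 1) := by
    have e : ∀ r : ℝ, r ^ 2 * (Set.Ioi 1).indicator (fun r => (r ^ (N + 4))⁻¹) r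
        = (Set.Ioi 1).indicator (fun r => r ^ (-(N + 2) : ℝ)) r := by
      intro r
      by_cases h : 1 < r
      · have h0 : 0 < r := one_pos.trans h
        simp only [Set.mem_Ioi, h, Set.indicator_of_mem]
        rw [Real.rpow_neg h0.le, show (N + 2 : ℝ) = (N + 2 : ℕ) by push_cast; ring,
          Real.rpow_natCast]
        field_simp
        ring
      · simp [h]
    simp only [e]
    have hN : (0 : ℝ) ≤ N := N.cast_nonneg
    rw [setIntegral_indicator measurableSet_Ioi, Set.Ioi_inter_Ioi, max_eq_right zero_le_one,
      integral_Ioi_rpow_of_lt (by linarith) one_pos, Real.one_rpow]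
    rw [div_eq_div_iff (by linarith) (by linarith)]
    ring
  have hmeas : MeasurableSet {x : R3 | 1 < ‖x‖} := measurableSet_lt measurable_const measurable_norm
  rw [← hr, ← integral_radial_smul_angular, ← integral_indicator hmeas,
    ← (rot (-1) 0 (by norm_num)).measurePreserving.integral_comp
      (rot (-1) 0 (by norm_num)).toHomeomorph.measurableEmbedding]
  refine integral_congr_ae (ae_ne_zero.mono fun x hx => ?_)
  by_cases h : 1 < ‖x‖
  · simp [h, hG _ (map_ne_zero_iff _ (LinearIsometryEquiv.injective _) |>.2 hx), barPt_rot]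
  · simp [h]

lemma kelvin_of_homogeneous {f : R3 → QH} {n : ℕ} (hom : ∀ (t : ℝ) x, f (t • x) = t ^ n • f x)
    (x : R3) : kelvin f x =
      ((‖x‖ ^ 3)⁻¹ * (‖x‖⁻¹) ^ n) • (toQbar x * f (‖x‖⁻¹ • barPt x)) := by
  rw [kelvin, show (‖x‖ ^ 2)⁻¹ • barPt x = ‖x‖⁻¹ • ‖x‖⁻¹ • barPt x by
    rw [smul_smul, ← mul_inv, sq], hom, smul_mul_smul_comm]

lemma star_kelvin_mul_kelvin {f h : R3 → QH} {n m : ℕ}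
    (fhom : ∀ (t : ℝ) x, f (t • x) = t ^ n • f x) (hhom : ∀ (t : ℝ) x, h (t • x) = t ^ m • h x)
    {x : R3} (hx : x ≠ 0) :
    star (kelvin f x) * kelvin h x = (‖x‖ ^ (n + m + 4))⁻¹ •
      (star (f (‖x‖⁻¹ • barPt x)) * h (‖x‖⁻¹ • barPt x)) := by
  have hx : ‖x‖ ≠ 0 := norm_ne_zero_iff.2 hx
  rw [kelvin_of_homogeneous fhom, kelvin_of_homogeneous hhom, ← starCLE_apply, map_smul,
    starCLE_apply, star_mul, star_toQbar, smul_mul_smul_comm, mul_assoc (star _),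
    ← mul_assoc (toQ x),
    toQ_mul_toQbar, smul_one_mul, mul_smul_comm, smul_smul]
  congr 1
  simp only [inv_pow]
  field_simp
  ring

lemma norm_sq_eq_re_star_mul_self (a : QH) : ‖a‖ ^ 2 = (star a * a).re := by
  rw [Quaternion.star_mul_self, sq, ← Quaternion.normSq_eq_norm_mul_self]
  rfl

lemma norm_kelvin_sq {f : R3 → QH} {n : ℕ} (hom : ∀ (t : ℝ) x, f (t • x) = t ^ n • f x)
    {x : R3} (hx : x ≠ 0) :
    ‖kelvin f x‖ ^ 2 = (‖x‖ ^ (n + n + 4))⁻¹ • ‖f (‖x‖⁻¹ • barPt x)‖ ^ 2 := by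
  rw [norm_sq_eq_re_star_mul_self, norm_sq_eq_re_star_mul_self, star_kelvin_mul_kelvin hom hom hx]
  simp

/-- orthogonality of the Kelvin transformed Appell functions over the
exterior of the unit ball, and the norm relation with the inner Appell polynomials. -/
theorem kelvin_appell_orthogonal_exterior :
    (∀ n l m k : ℕ, l ≤ n → k ≤ m → (n, l) ≠ (m, k) →
      ∫ x in {x : R3 | 1 < ‖x‖},
        star (kelvin (appell n l) x) * kelvin (appell m k) x = 0) ∧
    (∀ n l : ℕ, l ≤ n →
      ∫ x in {x : R3 | 1 < ‖x‖}, ‖kelvin (appell n l) x‖ ^ 2 =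
        ((2 * (n : ℝ) + 3) / (2 * (n : ℝ) + 1)) *
          ∫ x in ball (0 : R3) 1, ‖appell n l x‖ ^ 2) := by
  refine ⟨fun n l m k hl hk hne => ?_, fun n l hl => ?_⟩
  · rw [integral_exterior_of_inversion (N := n + m)
      (F := fun x => star (appell n l x) * appell m k x)
      fun x hx => star_kelvin_mul_kelvin (appell_smul hl) (appell_smul hk) hx,
      integral_sphere_appell_eq_zero hl hk hne, smul_zero]
  · rw [integral_exterior_of_inversion (N := n + n) (F := fun x => ‖appell n l x‖ ^ 2)
      fun x hx => norm_kelvin_sq (appell_smul hl) hx,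
      integral_ball_of_homogeneous (N := n + n) (F := fun x => ‖appell n l x‖ ^ 2)]
    · push_cast
      simp only [smul_eq_mul]
      rw [← mul_assoc]
      congr 1
      field_simp
      ring
    · intro t x
      rw [appell_smul hl, norm_smul, mul_pow, Real.norm_eq_abs, sq_abs, smul_eq_mul, ← pow_mul,
        ← two_mul, mul_comm n]
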